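/- arXiv:2010.01633 — 3 statements merged into one kernel-verified Lean document; each statement's English description precedes it below -/
import Mathlib

section
/- Let N, N_r, m, u, K_c, L be natural numbers with 1 ≤ m + u − 1 ≤ N_r ≤ N and L ≥ 1. Let T : ZMod N → ℝ be a function (T(n) represents the number of symbols transmitted by worker n). Suppose that for every n ∈ ZMod N one has ∑_{i=1}^{m+u−1} T(n + i) ≥ K_c · L. Then there exists a finite subset A of ZMod N with |A| = N_r such that (∑_{j ∈ A} T(j)) / L ≥ N_r · K_c / (m + u − 1). -/
/-- Core of the converse bound of Theorem 1 (case `K_c ≤ (K/N)(N_r - m + 1)`) under the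
cyclic assignment: if for every cyclic straggler pattern the `m + u - 1` designated
responding workers jointly transmit at least `K_c * L` symbols, then some set `A` of
`N_r` responding workers has normalized communication cost at least
`N_r * K_c / (m + u - 1)`. -/
theorem converse_bound_cyclic (N N_r m u K_c L : ℕ) [NeZero N]
    (h1 : 1 ≤ m + u - 1) (h2 : m + u - 1 ≤ N_r) (h3 : N_r ≤ N) (hL : 1 ≤ L)
    (T : ZMod N → ℝ)
    (h : ∀ n : ZMod N, (K_c : ℝ) * (L : ℝ) ≤ ∑ i ∈ Finset.Icc 1 (m + u - 1), T (n + (i : ZMod N))) :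
    ∃ A : Finset (ZMod N), A.card = N_r ∧
      (N_r : ℝ) * (K_c : ℝ) / ((m + u - 1 : ℕ) : ℝ) ≤ (∑ j ∈ A, T j) / (L : ℝ) := by
  classical
  set w := m + u - 1 with hw
  have hwpos : (0 : ℝ) < (w : ℝ) := by exact_mod_cast h1
  have hLpos : (0 : ℝ) < (L : ℝ) := by exact_mod_cast hL
  have shift : ∀ c : ZMod N, ∑ n : ZMod N, T (n + c) = ∑ n : ZMod N, T n := fun c =>
    Equiv.sum_comp (Equiv.addRight c) T
  -- total transmission over all the workers
  have hS : (N : ℝ) * ((K_c : ℝ) * (L : ℝ)) ≤ (w : ℝ) * ∑ n : ZMod N, T n := by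
    have hsum := Finset.sum_le_sum (fun n (_ : n ∈ (Finset.univ : Finset (ZMod N))) => h n)
    rw [Finset.sum_comm] at hsum
    simpa [shift, ZMod.card] using hsum
  -- some cyclic window of length `N_r` is at least the average
  obtain ⟨n, -, hn⟩ : ∃ n ∈ (Finset.univ : Finset (ZMod N)),
      (N_r : ℝ) * (K_c : ℝ) / (w : ℝ) * (L : ℝ) ≤
        ∑ i ∈ Finset.range N_r, T (n + (i : ZMod N)) := by
    apply Finset.exists_le_of_sum_le Finset.univ_nonempty
    rw [Finset.sum_comm]
    simp only [shift, Finset.sum_const, Finset.card_univ, ZMod.card, Finset.card_range,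
      nsmul_eq_mul]
    have e : (N : ℝ) * ((N_r : ℝ) * (K_c : ℝ) / (w : ℝ) * (L : ℝ)) =
        (N_r : ℝ) * ((N : ℝ) * ((K_c : ℝ) * (L : ℝ)) / (w : ℝ)) := by ring
    rw [e]
    apply mul_le_mul_of_nonneg_left _ (Nat.cast_nonneg _)
    rw [div_le_iff₀ hwpos]
    linarith
  have hinj : Set.InjOn (fun i : ℕ => n + (i : ZMod N)) (Finset.range N_r : Set ℕ) := by
    intro a ha b hb hab
    simp only [Finset.coe_range, Set.mem_Iio] at ha hb
    have habc : (a : ZMod N) = (b : ZMod N) := add_left_cancel hab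
    rw [ZMod.natCast_eq_natCast_iff', Nat.mod_eq_of_lt (by omega),
      Nat.mod_eq_of_lt (by omega)] at habc
    exact habc
  refine ⟨(Finset.range N_r).image (fun i : ℕ => n + (i : ZMod N)), ?_, ?_⟩
  · rw [Finset.card_image_of_injOn hinj, Finset.card_range]
  · rw [Finset.sum_image hinj, le_div_iff₀ hLpos]
    exact hn
end

section
/- Let N, w, u be natural numbers with w ≥ 1, u ≥ 1 and w + u − 1 < N (strictly), and let k, c ∈ ZMod N. Then the cyclic interval {k − i : i ∈ {0, …, w−1}} is contained in the cyclic interval {c − j : j ∈ {0, …, w+u−2}} if and only if there exists t ∈ {0, …, u−1} with k = c − t. -/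
/-- Characterization of exclusive assignment under the cyclic assignment: the cyclic
interval `{k - i : 0 ≤ i ≤ w-1}` is contained in the cyclic interval
`{c - j : 0 ≤ j ≤ w+u-2}` if and only if `k = c - t` for some `t ∈ {0, …, u-1}`. -/
theorem cyclic_interval_subset_iff (N w u : ℕ) (hw : 1 ≤ w) (hu : 1 ≤ u)
    (hwu : w + u - 1 < N) (k c : ZMod N) :
    (Finset.range w).image (fun i : ℕ => k - (i : ZMod N)) ⊆
        (Finset.range (w + u - 1)).image (fun j : ℕ => c - (j : ZMod N)) ↔
      ∃ t : ℕ, t < u ∧ k = c - (t : ZMod N) := by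
  constructor
  · intro h
    have key : ∀ i < w, ∃ j < w + u - 1, c - (j : ZMod N) = k - (i : ZMod N) := by
      intro i hi
      have := h (Finset.mem_image_of_mem _ (Finset.mem_range.2 hi))
      simpa only [Finset.mem_image, Finset.mem_range] using this
    obtain ⟨t, ht, hk⟩ := key 0 hw
    have hk' : k = c - (t : ZMod N) := by simpa using hk.symm
    have hstep : ∀ i < w, t + i < w + u - 1 := by
      intro i
      induction i with
      | zero => intro _; simpa using ht
      | succ i ih =>
        intro hi
        have h1 := ih (by omega)
        obtain ⟨j, hj, hjk⟩ := key (i + 1) hi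
        have h2 : ((t + (i + 1) : ℕ) : ZMod N) = (j : ZMod N) := by
          rw [hk'] at hjk
          push_cast at hjk ⊢
          linear_combination hjk
        rw [ZMod.natCast_eq_natCast_iff', Nat.mod_eq_of_lt (by omega),
          Nat.mod_eq_of_lt (by omega)] at h2
        omega
    have := hstep (w - 1) (by omega)
    exact ⟨t, by omega, hk'⟩
  · rintro ⟨t, ht, rfl⟩ x hx
    simp only [Finset.mem_image, Finset.mem_range] at hx ⊢
    obtain ⟨i, hi, rfl⟩ := hx
    exact ⟨t + i, by omega, by push_cast; ring⟩
end

section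
/- Let N, K, w, u be natural numbers with N ∣ K, w ≥ 1, u ≥ 1 and w + u − 1 < N, and let c ∈ ZMod N. Then the number of k ∈ {0, 1, …, K−1} such that the cyclic interval {(k mod N) − i : i ∈ {0, …, w−1}} ⊆ ZMod N is contained in the cyclic interval {c − j : j ∈ {0, …, w+u−2}} equals (K / N) · u. -/
theorem aux_mem (N L : ℕ) [NeZero N] (hL : L < N) (c x : ZMod N) :
    (∃ j, j < L ∧ c - (j : ZMod N) = x) ↔ (c - x).val < L := by
  constructor
  · rintro ⟨j, hj, rfl⟩
    rw [sub_sub_cancel, ZMod.val_natCast, Nat.mod_eq_of_lt (by omega)]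
    exact hj
  · intro h
    exact ⟨_, h, by rw [ZMod.natCast_zmod_val, sub_sub_cancel]⟩

theorem aux_iff (N w u : ℕ) [NeZero N] (hw : 1 ≤ w) (hu : 1 ≤ u) (hwu : w + u - 1 < N)
    (c x : ZMod N) :
    (∀ i, i < w → (c - (x - (i : ZMod N))).val < w + u - 1) ↔ (c - x).val < u := by
  have key : ∀ i : ℕ, c - (x - (i : ZMod N)) = (((c - x).val + i : ℕ) : ZMod N) := by
    intro i
    rw [Nat.cast_add, ZMod.natCast_zmod_val]
    ring
  simp only [key, ZMod.val_natCast]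
  have hd := ZMod.val_lt (c - x)
  generalize (c - x).val = d at *
  constructor
  · intro h
    by_contra hcon
    have h0 := h 0 (by omega)
    rw [Nat.add_zero, Nat.mod_eq_of_lt hd] at h0
    have h1 := h (w + u - 1 - d) (by omega)
    rw [Nat.mod_eq_of_lt (by omega)] at h1
    omega
  · intro h i hi
    rw [Nat.mod_eq_of_lt (by omega)]
    omega

theorem aux_count (N u q : ℕ) [NeZero N] (hu : u ≤ N) (c : ZMod N) :
    Nat.count (fun k : ℕ => (c - (k : ZMod N)).val < u) (N * q) = q * u := by
  induction q with
  | zero => simp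
  | succ q ih =>
    rw [Nat.mul_succ, Nat.count_add, ih, Nat.succ_mul]
    congr 1
    simp only [Nat.cast_add, Nat.cast_mul, CharP.cast_eq_zero, zero_mul, zero_add]
    rw [Nat.count_eq_card_filter_range]
    conv_rhs => rw [← Finset.card_range u]
    refine Finset.card_nbij' (fun k => (c - (k : ZMod N)).val)
      (fun k => (c - (k : ZMod N)).val) ?_ ?_ ?_ ?_
    · intro k hk
      simp only [Finset.coe_filter, Finset.mem_range, Set.mem_setOf_eq] at hk
      simpa using hk.2
    · intro k hk
      simp only [Finset.coe_range, Set.mem_Iio] at hk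
      simp only [Finset.coe_filter, Finset.mem_range, Set.mem_setOf_eq]
      refine ⟨ZMod.val_lt _, ?_⟩
      rw [ZMod.natCast_zmod_val, sub_sub_cancel, ZMod.val_natCast, Nat.mod_eq_of_lt (by omega)]
      exact hk
    · intro k hk
      simp only [Finset.coe_filter, Finset.mem_range, Set.mem_setOf_eq] at hk
      simp only [ZMod.natCast_zmod_val, sub_sub_cancel, ZMod.val_natCast]
      exact Nat.mod_eq_of_lt hk.1
    · intro k hk
      simp only [Finset.coe_range, Set.mem_Iio] at hk
      simp only [ZMod.natCast_zmod_val, sub_sub_cancel, ZMod.val_natCast]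
      exact Nat.mod_eq_of_lt (by omega)

open Classical in
/-- Exactly `(K/N) * u` of the datasets `k ∈ {0, …, K-1}` are exclusively assigned to
the workers of the cyclic interval of length `w + u - 1` ending at `c`, i.e. have their
worker set `{(k mod N) - i : 0 ≤ i ≤ w-1}` contained in `{c - j : 0 ≤ j ≤ w+u-2}`. -/
theorem count_exclusively_assigned_datasets (N K w u : ℕ) (hNK : N ∣ K)
    (hw : 1 ≤ w) (hu : 1 ≤ u) (hwu : w + u - 1 < N) (c : ZMod N) :
    ((Finset.range K).filter (fun k : ℕ =>
        (Finset.range w).image (fun i : ℕ => ((k : ZMod N)) - (i : ZMod N)) ⊆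
          (Finset.range (w + u - 1)).image (fun j : ℕ => c - (j : ZMod N)))).card =
      (K / N) * u := by
  have hN : 0 < N := by omega
  haveI : NeZero N := ⟨by omega⟩
  obtain ⟨q, rfl⟩ := hNK
  rw [Nat.mul_div_cancel_left q hN, ← aux_count N u q (by omega) c,
    Nat.count_eq_card_filter_range]
  congr 1
  ext k
  simp only [Finset.mem_filter]
  refine and_congr_right fun _ => ?_
  rw [← aux_iff N w u hw hu hwu c k, Finset.image_subset_iff]
  simp only [Finset.mem_range, Finset.mem_image, aux_mem N _ hwu]
end
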